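/- Bypass construction via the effective radius: let x, y ∈ Z^d, let γ ∈ G_*(x,y), and let e be an edge of γ such that x, y ∉ Λ_{3R_e}(e). Then there exists a path η_e ∈ G_*(x,y) such that: (i) η_e ∩ Λ_{R_e}(e) = ∅, and η_e \ γ is an open path contained in the annulus A_{R_e}(e); (ii) |η_e \ γ| ≤ C_* R_e. -/

import Mathlib

open MeasureTheory
open scoped ENNReal NNReal

attribute [local instance] Classical.propDecidable

noncomputable section

namespace Perco

/-- Vertices of the lattice `ℤ^d`. -/
abbrev ZVec (d : ℕ) := Fin d → ℤ

/-- The `ℓ¹` norm of a lattice point (as a natural number). -/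
def norm1 (d : ℕ) (x : ZVec d) : ℕ := ∑ i, (x i).natAbs

/-- The `ℓ∞` norm of a lattice point (as a natural number). -/
def normInf (d : ℕ) (x : ZVec d) : ℕ := Finset.univ.sup fun i => (x i).natAbs

/-- Nearest-neighbour edges of `ℤ^d`, each written `(x_e, y_e)` with `‖x_e‖₁ < ‖y_e‖₁`. -/
def EdgeD (d : ℕ) := {e : ZVec d × ZVec d // norm1 d (e.1 - e.2) = 1 ∧ norm1 d e.1 < norm1 d e.2}

/-- A percolation configuration: each edge is open (`true`) or closed (`false`). -/
abbrev Config (d : ℕ) := EdgeD d → Bool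

/-- Adjacency in `ℤ^d`. -/
def Adj (d : ℕ) (x y : ZVec d) : Prop := norm1 d (x - y) = 1

/-- A (self-avoiding, nearest-neighbour) path, recorded as its list of vertices. -/
def IsPath (d : ℕ) (γ : List (ZVec d)) : Prop :=
  γ ≠ [] ∧ γ.Nodup ∧ γ.Chain' (Adj d)

/-- The (unordered) edge `{x,y}` is open in the configuration `ω`. -/
def EdgeOpen (d : ℕ) (ω : Config d) (x y : ZVec d) : Prop :=
  ∃ e : EdgeD d, (e.val = (x, y) ∨ e.val = (y, x)) ∧ ω e = true

/-- All edges of the path are open. -/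
def IsOpenPath (d : ℕ) (ω : Config d) (γ : List (ZVec d)) : Prop :=
  γ.Chain' (EdgeOpen d ω)

/-- The (unordered) edge `{x,y}` is an edge of the path `γ`. -/
def edgeMemPath (d : ℕ) (x y : ZVec d) (γ : List (ZVec d)) : Prop :=
  (x, y) ∈ γ.zip γ.tail ∨ (y, x) ∈ γ.zip γ.tail

/-- Truncated FPP weight of the edge `{x,y}`: `1` if open, `log² n` if closed. -/
def pairWeight (d n : ℕ) (ω : Config d) (x y : ZVec d) : ℝ :=
  if EdgeOpen d ω x y then 1 else (Real.log n) ^ 2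

/-- Total truncated weight of a path. -/
def pathCost (d n : ℕ) (ω : Config d) : List (ZVec d) → ℝ
  | [] => 0
  | [_] => 0
  | x :: y :: rest => pairWeight d n ω x y + pathCost d n ω (y :: rest)

/-- Truncated first-passage time between `x` and `y`. -/
def passageTime (d n : ℕ) (ω : Config d) (x y : ZVec d) : ℝ :=
  sInf {c : ℝ | ∃ γ : List (ZVec d), IsPath d γ ∧ γ.head? = some x ∧
    γ.getLast? = some y ∧ pathCost d n ω γ = c}

/-- Chemical distance between `x` and `y` using only open paths inside `U`. -/
def chemDistIn (d : ℕ) (ω : Config d) (U : Set (ZVec d)) (x y : ZVec d) : ℕ∞ :=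
  sInf {k : ℕ∞ | ∃ γ : List (ZVec d), IsPath d γ ∧ IsOpenPath d ω γ ∧ (∀ v ∈ γ, v ∈ U) ∧
    γ.head? = some x ∧ γ.getLast? = some y ∧ ((γ.length - 1 : ℕ) : ℕ∞) = k}

/-- Chemical distance in the whole lattice. -/
def chemDist (d : ℕ) (ω : Config d) (x y : ZVec d) : ℕ∞ := chemDistIn d ω Set.univ x y

/-- `x` belongs to an infinite open cluster. -/
def InInfCluster (d : ℕ) (ω : Config d) (x : ZVec d) : Prop :=
  {y | chemDist d ω x y ≠ ⊤}.Infinite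

/-- `x*`: a point of the infinite cluster at minimal `ℓ∞`-distance from `x`
(deterministic tie-breaking via choice); `x` itself if there is no infinite cluster. -/
def starPt (d : ℕ) (ω : Config d) (x : ZVec d) : ZVec d :=
  if h : ∃ y, InInfCluster d ω y ∧ ∀ z, InInfCluster d ω z →
      normInf d (y - x) ≤ normInf d (z - x)
  then h.choose else x

/-- `μ` is the Bernoulli(p) bond-percolation product measure on configurations. -/
def IsBernoulli (d : ℕ) (p : ℝ) (μ : Measure (Config d)) : Prop :=
  IsProbabilityMeasure μ ∧
  ∀ (s : Finset (EdgeD d)) (f : EdgeD d → Bool),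
    μ {ω | ∀ e ∈ s, ω e = f e} = ∏ e ∈ s, ENNReal.ofReal (if f e then p else 1 - p)

/-- The critical parameter of Bernoulli bond percolation on `ℤ^d`. -/
def pc (d : ℕ) : ℝ :=
  sSup {p : ℝ | 0 ≤ p ∧ p ≤ 1 ∧ ∀ μ : Measure (Config d), IsBernoulli d p μ →
    μ {ω | ∃ x, InInfCluster d ω x} = 0}

/-- The point `n·e₁`. -/
def ptE1 (d n : ℕ) : ZVec d := fun i => if (i : ℕ) = 0 then (n : ℤ) else 0

/-- `D*_n = D(0*, (n e₁)*)`, as a real number. -/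
def DstarR (d n : ℕ) (ω : Config d) : ℝ :=
  ((chemDist d ω (starPt d ω 0) (starPt d ω (ptE1 d n))).toNat : ℝ)

/-- `T_n = T(0, n e₁)`, the truncated passage time. -/
def TnR (d n : ℕ) (ω : Config d) : ℝ := passageTime d n ω 0 (ptE1 d n)

/-- The box `Λ_t(z)` with integer radius. -/
def boxZ (d : ℕ) (t : ℕ) (z : ZVec d) : Set (ZVec d) := {y | normInf d (y - z) ≤ t}

/-- The box `Λ_t(z)` with real radius. -/
def boxR (d : ℕ) (t : ℝ) (z : ZVec d) : Set (ZVec d) := {y | (normInf d (y - z) : ℝ) ≤ t}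

/-- The annulus `A_N(e) = Λ_{3N}(e) \ Λ_N(e)`. -/
def annulus (d : ℕ) (N : ℕ) (e : EdgeD d) : Set (ZVec d) :=
  {y | normInf d (y - e.val.1) ≤ 3 * N ∧ N < normInf d (y - e.val.1)}

/-- `π` is a geodesic of the truncated passage time between its endpoints, inside `A`. -/
def IsGeodesicIn (d n : ℕ) (ω : Config d) (A : Set (ZVec d)) (π : List (ZVec d)) : Prop :=
  IsPath d π ∧ (∀ v ∈ π, v ∈ A) ∧
  ∀ π' : List (ZVec d), IsPath d π' → (∀ v ∈ π', v ∈ A) →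
    π'.head? = π.head? → π'.getLast? = π.getLast? →
    pathCost d n ω π ≤ pathCost d n ω π'

/-- `γ ∈ 𝔾_*(A)`: a path in `A` obtained from some geodesic in `A` by replacing
segments by open paths (all edges of `γ` not on the geodesic are open). -/
def GstarIn (d n : ℕ) (ω : Config d) (A : Set (ZVec d)) (γ : List (ZVec d)) : Prop :=
  IsPath d γ ∧ (∀ v ∈ γ, v ∈ A) ∧
  ∃ π : List (ZVec d), IsGeodesicIn d n ω A π ∧
    ∀ x y, edgeMemPath d x y γ → ¬ edgeMemPath d x y π → EdgeOpen d ω x y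

/-- `γ` is a crossing path of the annulus `A_N(e)`. -/
def IsCrossing (d : ℕ) (N : ℕ) (e : EdgeD d) (γ : List (ZVec d)) : Prop :=
  IsPath d γ ∧ (∀ v ∈ γ, v ∈ annulus d N e) ∧
  (∃ v ∈ γ, normInf d (v - e.val.1) = N + 1) ∧ (∃ v ∈ γ, normInf d (v - e.val.1) = 3 * N)

/-- The event `𝒱¹_N(e)`: any two modified geodesics crossing `A_N(e)` are linked by an
open path inside `A_N(e)` of length at most `C_* N`. -/
def V1 (d : ℕ) (Cstar : ℝ) (n : ℕ) (e : EdgeD d) (N : ℕ) (ω : Config d) : Prop :=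
  ∀ γ1 γ2 : List (ZVec d),
    GstarIn d n ω (boxR d (Cstar * N) e.val.1) γ1 → IsCrossing d N e γ1 →
    GstarIn d n ω (boxR d (Cstar * N) e.val.1) γ2 → IsCrossing d N e γ2 →
    ∃ π : List (ZVec d), IsPath d π ∧ IsOpenPath d ω π ∧ (∀ v ∈ π, v ∈ annulus d N e) ∧
      (∃ u, π.head? = some u ∧ u ∈ γ1) ∧ (∃ v, π.getLast? = some v ∧ v ∈ γ2) ∧
      ((π.length : ℝ) - 1 ≤ Cstar * N)

/-- The event `𝒱²_N(e)`: points of `Λ_{3N}(e)` openly connected inside `Λ_{3N}(e)` are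
connected inside `Λ_{4N}(e)` by an open path of length at most `C_* N`. -/
def V2 (d : ℕ) (Cstar : ℝ) (e : EdgeD d) (N : ℕ) (ω : Config d) : Prop :=
  ∀ x y : ZVec d, x ∈ boxZ d (3 * N) e.val.1 → y ∈ boxZ d (3 * N) e.val.1 →
    (∃ γ, IsPath d γ ∧ IsOpenPath d ω γ ∧ (∀ v ∈ γ, v ∈ boxZ d (3 * N) e.val.1) ∧
      γ.head? = some x ∧ γ.getLast? = some y) →
    ∃ γ, IsPath d γ ∧ IsOpenPath d ω γ ∧ (∀ v ∈ γ, v ∈ boxZ d (4 * N) e.val.1) ∧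
      γ.head? = some x ∧ γ.getLast? = some y ∧ ((γ.length : ℝ) - 1 ≤ Cstar * N)

/-- The effective radius `R_e` as a natural number (`0` when undefined). -/
def ReffN (d : ℕ) (Cstar : ℝ) (n : ℕ) (e : EdgeD d) (ω : Config d) : ℕ :=
  sInf {N : ℕ | 1 ≤ N ∧ V1 d Cstar n e N ω ∧ V2 d Cstar e N ω}

/-- The effective radius `R_e`, valued in `ℝ≥0∞` (`∞` when undefined). -/
def ReffENN (d : ℕ) (Cstar : ℝ) (n : ℕ) (e : EdgeD d) (ω : Config d) : ℝ≥0∞ :=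
  sInf {r : ℝ≥0∞ | ∃ N : ℕ, r = N ∧ 1 ≤ N ∧ V1 d Cstar n e N ω ∧ V2 d Cstar e N ω}

/-- The truncated effective radius `R̂_e = min (C_* R_e) (log² n)`. -/
def RhatR (d : ℕ) (Cstar : ℝ) (n : ℕ) (e : EdgeD d) (ω : Config d) : ℝ :=
  (min (ENNReal.ofReal Cstar * ReffENN d Cstar n e ω)
    (ENNReal.ofReal ((Real.log n) ^ 2))).toReal

/-- `diam(γ) ≥ r`. -/
def DiamGE (d : ℕ) (γ : List (ZVec d)) (r : ℝ) : Prop :=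
  ∃ i : Fin d, ∃ x ∈ γ, ∃ y ∈ γ, r ≤ |((x i : ℤ) : ℝ) - ((y i : ℤ) : ℝ)|

/-- The boundary `∂Λ_t` (real radius `t`). -/
def bdryR (d : ℕ) (t : ℝ) : Set (ZVec d) :=
  {x | (normInf d x : ℝ) ≤ t ∧ t - 1 < (normInf d x : ℝ)}

/-- The slab `S(ℓ,t) = {x ∈ Λ_t : 0 ≤ x₁ ≤ ℓ}`. -/
def slab (d : ℕ) (l t : ℝ) : Set (ZVec d) :=
  {x | (normInf d x : ℝ) ≤ t ∧ ∀ i : Fin d, (i : ℕ) = 0 → 0 ≤ x i ∧ ((x i : ℤ) : ℝ) ≤ l}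

/-- The open cluster of the vertex `v`. -/
def openClusterOf (d : ℕ) (ω : Config d) (v : ZVec d) : Set (ZVec d) :=
  {y | chemDist d ω v y ≠ ⊤}

/-- The set `C` crosses the box `Λ_t(z)`: in each direction an open path of `C ∩ Λ_t(z)`
connects the two opposite faces. -/
def CrossesBox (d : ℕ) (ω : Config d) (C : Set (ZVec d)) (t : ℕ) (z : ZVec d) : Prop :=
  ∀ i : Fin d, ∃ γ, IsPath d γ ∧ IsOpenPath d ω γ ∧ (∀ u ∈ γ, u ∈ C ∧ u ∈ boxZ d t z) ∧
    (∃ u ∈ γ, u i = z i - t) ∧ (∃ u ∈ γ, u i = z i + t)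

/-- The event `𝓔_N`: some crossing open cluster of `Λ_{2N}` is avoided by a modified
geodesic `π ⊆ Λ_N` of diameter at least `N/2` belonging to `𝔾_*(Λ_{tN})`. -/
def ENevent (d n : ℕ) (t : ℝ) (N : ℕ) : Set (Config d) :=
  {ω | ∃ v0 : ZVec d, CrossesBox d ω (openClusterOf d ω v0) (2 * N) 0 ∧
    ∃ π : List (ZVec d), IsPath d π ∧ (∀ u ∈ π, u ∈ boxZ d N 0) ∧
      GstarIn d n ω (boxR d (t * N) 0) π ∧ DiamGE d π ((N : ℝ) / 2) ∧
      ∀ u ∈ π, u ∉ openClusterOf d ω v0}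

/-- `ρ` is a Garet–Marchand moderate-deviation constant for the chemical distance. -/
def GMprop (d : ℕ) (μ : Measure (Config d)) (ρ : ℝ) : Prop :=
  1 ≤ ρ ∧ ∃ c : ℝ, 0 < c ∧ ∀ x : ZVec d, ∀ t : ℝ, ρ * (normInf d x : ℝ) ≤ t →
    μ {ω | chemDist d ω 0 x ≠ ⊤ ∧ t ≤ ((chemDist d ω 0 x).toNat : ℝ)}
      ≤ ENNReal.ofReal (c⁻¹ * Real.exp (-c * t)) ∧
    μ {ω | t ≤ ((chemDist d ω (starPt d ω 0) (starPt d ω x)).toNat : ℝ) ∨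
        chemDist d ω (starPt d ω 0) (starPt d ω x) = ⊤}
      ≤ ENNReal.ofReal (c⁻¹ * Real.exp (-c * t))

/-- `cs` is a constant for which the crossing-cluster avoidance lemma holds. -/
def CrossProp (d : ℕ) (μ : Measure (Config d)) (cs : ℝ) : Prop :=
  0 < cs ∧ cs < 1 ∧ ∀ n : ℕ, 2 ≤ n → ∀ t : ℝ, 1 / cs ≤ t → ∀ N : ℕ, 1 ≤ N →
    (N : ℝ) ≤ Real.exp (cs * (Real.log n) ^ 2) →
    μ (ENevent d n t N) ≤ ENNReal.ofReal (cs⁻¹ * Real.exp (-cs * N))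

/-- `N_ρ = ⌊N / (16 ρ²)⌋`. -/
def Nrho (ρ : ℝ) (N : ℕ) : ℕ := Nat.floor ((N : ℝ) / (16 * ρ ^ 2))

/-- The cube of side-length `m` with lower corner `z`. -/
def cube (d : ℕ) (m : ℕ) (z : ZVec d) : Set (ZVec d) :=
  {y | ∀ i, z i ≤ y i ∧ y i ≤ z i + m}

/-- The open cluster of `v` inside `U`. -/
def clusterIn (d : ℕ) (ω : Config d) (U : Set (ZVec d)) (v : ZVec d) : Set (ZVec d) :=
  {y | chemDistIn d ω U v y ≠ ⊤}

/-- `k ≤ r` for `k : ℕ∞` and `r : ℝ` (in particular `k` is finite). -/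
def chemLE (k : ℕ∞) (r : ℝ) : Prop := ∃ m : ℕ, k = (m : ℕ∞) ∧ (m : ℝ) ≤ r

/-- The box `Λ_{3N}(e)` is good (Definition 2.2 of the paper). -/
def GoodBox (d n : ℕ) (ρ Cstar : ℝ) (e : EdgeD d) (N : ℕ) (ω : Config d) : Prop :=
  (∃ v0 ∈ boxZ d (3 * N) e.val.1,
    (∀ z : ZVec d, cube d (Nrho ρ N) z ⊆ boxZ d (3 * N) e.val.1 →
      ∀ i : Fin d, ∃ γ, IsPath d γ ∧ IsOpenPath d ω γ ∧
        (∀ u ∈ γ, u ∈ clusterIn d ω (boxZ d (3 * N) e.val.1) v0 ∧ u ∈ cube d (Nrho ρ N) z) ∧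
        (∃ u ∈ γ, u i = z i) ∧ (∃ u ∈ γ, u i = z i + (Nrho ρ N : ℤ))) ∧
    (∀ π, IsPath d π → (∀ u ∈ π, u ∈ boxZ d (3 * N) e.val.1) →
      GstarIn d n ω (boxR d (Cstar * N) e.val.1) π → DiamGE d π ((Nrho ρ N : ℝ)) →
      ∃ u ∈ π, u ∈ clusterIn d ω (boxZ d (3 * N) e.val.1) v0)) ∧
  (∀ x y : ZVec d, x ∈ boxZ d (3 * N) e.val.1 → y ∈ boxZ d (3 * N) e.val.1 →
    normInf d (x - y) ≤ 2 * Nrho ρ N → chemDist d ω x y ≠ ⊤ →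
    chemDistIn d ω (boxZ d (4 * N) e.val.1) x y = chemDist d ω x y ∧
    chemLE (chemDist d ω x y) (4 * ρ * (Nrho ρ N : ℝ))) ∧
  (∀ x y : ZVec d, x ∈ annulus d N e → y ∈ annulus d N e →
    (∀ b : ZVec d, (normInf d (b - e.val.1) = N ∨ normInf d (b - e.val.1) = 3 * N) →
      (N : ℝ) / 2 ≤ (normInf d (x - b) : ℝ) ∧ (N : ℝ) / 2 ≤ (normInf d (y - b) : ℝ)) →
    normInf d (x - y) ≤ 2 * Nrho ρ N → chemDist d ω x y ≠ ⊤ →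
    chemDistIn d ω (annulus d N e) x y = chemDist d ω x y ∧
    chemLE (chemDist d ω x y) (4 * ρ * (Nrho ρ N : ℝ)))

/-- Evaluate an edge-indexed function at the (unordered) pair `{x,y}`, `0` if not an edge. -/
def edgeFnVal (d : ℕ) (g : EdgeD d → ℝ) (x y : ZVec d) : ℝ :=
  if h : ∃ e : EdgeD d, e.val = (x, y) ∨ e.val = (y, x) then g h.choose else 0

/-- The sum of `g` over the edges of the path `γ`. -/
def pathSum (d : ℕ) (g : EdgeD d → ℝ) (γ : List (ZVec d)) : ℝ :=
  ((γ.zip γ.tail).map fun pr => edgeFnVal d g pr.1 pr.2).sum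

/-- Number of edges of `η` that are not edges of `γ`, i.e. `|η \ γ|`. -/
def diffEdgeCount (d : ℕ) (η γ : List (ZVec d)) : ℕ :=
  ((η.zip η.tail).filter fun pr => decide (¬ edgeMemPath d pr.1 pr.2 γ)).length

/-- Maximal total weight of a lattice animal (path) in `Ξ_L`. -/
def animalMax (d : ℕ) (L : ℕ) (g : EdgeD d → ℝ) : ℝ :=
  sSup {r : ℝ | ∃ γ : List (ZVec d), IsPath d γ ∧ (∀ v ∈ γ, v ∈ boxZ d L 0) ∧
    γ.length ≤ L + 1 ∧ r = pathSum d g γ}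

/-- `m = ⌊n^{1/4}⌋`. -/
def mOf (n : ℕ) : ℕ := Nat.floor ((n : ℝ) ^ ((1 : ℝ) / 4))

/-- The box `Λ_m` as a finite set. -/
def boxFinset (d m : ℕ) : Finset (ZVec d) := Finset.Icc (fun _ => -(m : ℤ)) (fun _ => (m : ℤ))

/-- The spatially averaged passage time `F_m`. -/
def Fm (d n : ℕ) (ω : Config d) : ℝ :=
  (∑ z ∈ boxFinset d (mOf n), passageTime d n ω z (z + ptE1 d n)) / (boxFinset d (mOf n)).card

/-- The σ-algebra generated by the states of the first `i` edges. -/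
def edgeFiltration (d : ℕ) (ε : ℕ ≃ EdgeD d) (i : ℕ) : MeasurableSpace (Config d) :=
  MeasurableSpace.comap (fun ω (j : Fin i) => ω (ε j)) MeasurableSpace.pi

/-- The martingale increment `Δ_i = E[e^{λ F_m} | 𝓕_i] − E[e^{λ F_m} | 𝓕_{i−1}]`. -/
def mgDelta (d n : ℕ) (ε : ℕ ≃ EdgeD d) (lam : ℝ) (μ : Measure (Config d)) (i : ℕ) :
    Config d → ℝ :=
  fun ω => (μ[fun ω' => Real.exp (lam * Fm d n ω') | edgeFiltration d ε i]) ω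
    - (μ[fun ω' => Real.exp (lam * Fm d n ω') | edgeFiltration d ε (i - 1)]) ω

/-- The entropy `Ent[X] = E[X log (X / E[X])]`. -/
def entOf {α : Type*} [MeasurableSpace α] (μ : Measure α) (X : α → ℝ) : ℝ :=
  ∫ ω, X ω * Real.log (X ω / ∫ ω', X ω' ∂μ) ∂μ

end Perco
namespace Perco

section Lists

variable {α : Type*}

/-- The consecutive pairs of a list. -/
def steps (l : List α) : List (α × α) := l.zip l.tail

@[simp] lemma steps_nil : steps ([] : List α) = [] := rfl

@[simp] lemma steps_singleton (a : α) : steps [a] = [] := rfl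

@[simp] lemma steps_cons_cons (a b : α) (l : List α) :
    steps (a :: b :: l) = (a, b) :: steps (b :: l) := rfl

lemma steps_append_cons (A : List α) (p : α) (B : List α) :
    steps (A ++ p :: B) = steps (A ++ [p]) ++ steps (p :: B) := by
  induction A with
  | nil => simp
  | cons a A ih => cases A <;> simp_all

lemma exists_eq_cons_of_head? {s : List α} {p : α} (h : s.head? = some p) :
    ∃ t, s = p :: t := by
  cases s with
  | nil => simp at h
  | cons a t => exact ⟨t, by simpa using h⟩

lemma exists_eq_concat_of_getLast? {s : List α} {q : α} (h : s.getLast? = some q) :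
    ∃ t, s = t ++ [q] :=
  List.getLast?_eq_some_iff.1 h

lemma steps_append_of_head? (A : List α) {s : List α} {p : α} (h : s.head? = some p) :
    steps (A ++ s) = steps (A ++ [p]) ++ steps s := by
  obtain ⟨t, rfl⟩ := exists_eq_cons_of_head? h
  exact steps_append_cons A p t

lemma steps_append_of_getLast? {s : List α} (B : List α) {q : α} (h : s.getLast? = some q) :
    steps (s ++ B) = steps s ++ steps (q :: B) := by
  obtain ⟨t, rfl⟩ := exists_eq_concat_of_getLast? h
  simpa using steps_append_cons t q B

lemma chain'_iff_steps {r : α → α → Prop} {l : List α} :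
    l.Chain' r ↔ ∀ p ∈ steps l, r p.1 p.2 := by
  change List.IsChain r l ↔ _
  induction l with
  | nil => simp
  | cons a l ih => cases l <;> simp_all

lemma fst_mem_of_mem_steps_concat {A : List α} {h : α} {p : α × α}
    (hp : p ∈ steps (A ++ [h])) : p.1 ∈ A := by
  induction A with
  | nil => simp at hp
  | cons a A ih =>
    cases A with
    | nil => simp_all
    | cons b A =>
      simp only [List.cons_append, steps_cons_cons, List.mem_cons] at hp ih ⊢
      rcases hp with rfl | hp
      · simp
      · exact Or.inr (ih hp)

lemma snd_mem_of_mem_steps_cons {B : List α} {h : α} {p : α × α}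
    (hp : p ∈ steps (h :: B)) : p.2 ∈ B := by
  induction B generalizing h with
  | nil => simp at hp
  | cons b B ih =>
    simp only [steps_cons_cons, List.mem_cons] at hp ⊢
    rcases hp with rfl | hp
    · simp
    · exact Or.inr (ih hp)

lemma mem_of_mem_steps {l : List α} {p : α × α} (hp : p ∈ steps l) : p.1 ∈ l ∧ p.2 ∈ l :=
  ⟨(List.of_mem_zip hp).1, List.mem_of_mem_tail (List.of_mem_zip hp).2⟩

lemma steps_reverse_swap {l : List α} {a b : α} :
    (a, b) ∈ steps l.reverse ↔ (b, a) ∈ steps l := by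
  induction l with
  | nil => simp
  | cons c l ih =>
    cases l with
    | nil => simp
    | cons c' l =>
      rw [List.reverse_cons, List.reverse_cons, List.append_assoc, List.singleton_append,
        steps_append_cons, ← List.reverse_cons, List.mem_append, ih]
      simp only [steps_cons_cons, steps_singleton, List.mem_cons, List.not_mem_nil, or_false,
        Prod.mk.injEq]
      tauto

lemma mem_steps_of_infix {l m : List α} (h : m <:+: l) {p : α × α} (hp : p ∈ steps m) :
    p ∈ steps l := by
  obtain ⟨A, B, rfl⟩ := h
  cases m with
  | nil => simp at hp
  | cons a m =>
    rw [List.append_assoc, List.cons_append, steps_append_cons, ← List.cons_append]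
    obtain ⟨t, q, h⟩ : ∃ t q, a :: m = t ++ [q] :=
      ⟨_, _, (List.dropLast_append_getLast (List.cons_ne_nil a m)).symm⟩
    rw [steps_append_of_getLast? (q := q) B (by simp [h])]
    simp [hp]

lemma exists_first_split {P : α → Prop} {l : List α} (h : ∃ v ∈ l, P v) :
    ∃ A v B, l = A ++ v :: B ∧ P v ∧ ∀ u ∈ A, ¬ P u := by
  induction l with
  | nil => simp at h
  | cons a l ih =>
    by_cases ha : P a
    · exact ⟨[], a, l, by simp [ha]⟩
    · obtain ⟨A, v, B, rfl, hv, hA⟩ := ih (by simpa [ha] using h)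
      exact ⟨a :: A, v, B, by simp, hv, by simpa [ha] using hA⟩

lemma exists_last_split {P : α → Prop} {l : List α} (h : ∃ v ∈ l, P v) :
    ∃ A v B, l = A ++ v :: B ∧ P v ∧ ∀ u ∈ B, ¬ P u := by
  obtain ⟨A, v, B, hl, hv, hA⟩ := exists_first_split (l := l.reverse) (P := P) (by simpa using h)
  refine ⟨B.reverse, v, A.reverse, ?_, hv, by simpa using hA⟩
  rw [← List.reverse_reverse l, hl]
  simp

/-- The part of a list between the first and the last element with property `P`. -/
lemma exists_hull_split {P : α → Prop} {l : List α} (h : ∃ v ∈ l, P v) :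
    ∃ A m B a b, l = A ++ m ++ B ∧ m.head? = some a ∧ m.getLast? = some b ∧ P a ∧ P b ∧
      (∀ u ∈ A, ¬ P u) ∧ ∀ u ∈ B, ¬ P u := by
  obtain ⟨A, a, l', rfl, ha, hA⟩ := exists_first_split h
  obtain ⟨m, b, B, hl, hb, hB⟩ := exists_last_split (P := P) (l := a :: l') ⟨a, by simp, ha⟩
  refine ⟨A, m ++ [b], B, a, b, by simp [hl], ?_, by simp, ha, hb, hA, hB⟩
  cases m <;> simp_all

/-- Loop erasure. -/
lemma exists_loop_erasure {l : List α} (hl : l ≠ []) :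
    ∃ l', l' ≠ [] ∧ l'.Nodup ∧ l'.head? = l.head? ∧ l'.getLast? = l.getLast? ∧
      (∀ v ∈ l', v ∈ l) ∧ (steps l').Sublist (steps l) := by
  induction l with
  | nil => exact absurd rfl hl
  | cons a t ih =>
    cases t with
    | nil => exact ⟨[a], by simp⟩
    | cons b t =>
      obtain ⟨l', hne, hnd, hh, hlast, hsub, hst⟩ := ih (by simp)
      by_cases ha : a ∈ l'
      · obtain ⟨s, r, rfl⟩ := List.append_of_mem ha
        refine ⟨a :: r, by simp, hnd.of_append_right, rfl, ?_, ?_, ?_⟩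
        · rw [List.getLast?_cons_cons, ← hlast]
          simp [List.getLast?_append, List.getLast?_cons]
        · intro v hv
          exact List.mem_cons_of_mem _ (hsub v (by simp at hv ⊢; tauto))
        · rw [steps_append_cons] at hst
          exact ((List.sublist_append_right _ _).trans hst).trans (List.sublist_cons_self _ _)
      · obtain ⟨r, rfl⟩ := exists_eq_cons_of_head? (hh.trans (List.head?_cons))
        refine ⟨a :: b :: r, by simp, List.nodup_cons.2 ⟨ha, hnd⟩, rfl, ?_, ?_, ?_⟩
        · simpa using hlast
        · intro v hv
          rcases List.mem_cons.1 hv with rfl | hv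
          · simp
          · exact List.mem_cons_of_mem _ (hsub v hv)
        · simpa using hst

lemma length_steps (l : List α) : (steps l).length = l.length - 1 := by
  simp [steps]

end Lists

section Norms

variable {d : ℕ}

lemma natAbs_le_normInf (x : ZVec d) (i : Fin d) : (x i).natAbs ≤ normInf d x :=
  Finset.le_sup (f := fun i => (x i).natAbs) (Finset.mem_univ i)

lemma normInf_sub_le (a b c : ZVec d) :
    normInf d (a - c) ≤ normInf d (a - b) + normInf d (b - c) := by
  refine Finset.sup_le fun i _ => ?_
  have h1 := natAbs_le_normInf (a - b) i
  have h2 := natAbs_le_normInf (b - c) i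
  simp only [Pi.sub_apply] at *
  omega

lemma normInf_sub_comm (a b : ZVec d) : normInf d (a - b) = normInf d (b - a) := by
  unfold normInf
  congr 1
  ext
  simp only [Pi.sub_apply]
  omega

lemma norm1_sub_comm (a b : ZVec d) : norm1 d (a - b) = norm1 d (b - a) := by
  unfold norm1
  congr 1
  ext
  simp only [Pi.sub_apply]
  omega

lemma normInf_le_norm1 (x : ZVec d) : normInf d x ≤ norm1 d x :=
  Finset.sup_le fun _ hi =>
    Finset.single_le_sum (f := fun i => (x i).natAbs) (fun _ _ => Nat.zero_le _) hi

lemma norm1_le_mul_normInf (x : ZVec d) : norm1 d x ≤ d * normInf d x := by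
  simpa [norm1] using Finset.sum_le_card_nsmul Finset.univ (fun i => (x i).natAbs) _
    fun i _ => natAbs_le_normInf x i

lemma norm1_eq_zero {x : ZVec d} (h : norm1 d x = 0) : x = 0 := by
  ext i
  simpa using (Finset.sum_eq_zero_iff.1 h) i (Finset.mem_univ i)

lemma Adj.symm {a b : ZVec d} (h : Adj d a b) : Adj d b a := by
  rwa [Adj, norm1_sub_comm]

lemma Adj.normInf_le {a b : ZVec d} (h : Adj d a b) : normInf d (a - b) ≤ 1 :=
  (normInf_le_norm1 _).trans_eq h

lemma Adj.normInf_sub_le {a b : ZVec d} (h : Adj d a b) (z : ZVec d) :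
    normInf d (a - z) ≤ normInf d (b - z) + 1 := by
  have := Perco.normInf_sub_le a b z
  have := h.normInf_le
  omega

lemma exists_adj_norm1_lt {x y : ZVec d} (h : norm1 d (x - y) ≠ 0) :
    ∃ z, Adj d x z ∧ norm1 d (z - y) + 1 = norm1 d (x - y) := by
  obtain ⟨i, hi⟩ : ∃ i, x i - y i ≠ 0 := by
    by_contra! hc
    exact h (Finset.sum_eq_zero fun i _ => by simp [hc i])
  refine ⟨Function.update x i (x i - (x i - y i).sign), ?_, ?_⟩
  · rw [Adj, norm1, Finset.sum_eq_single i]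
    · simp [Int.natAbs_sign, hi]
    · intro j _ hj
      simp [Function.update_of_ne hj]
    · simp
  · rw [norm1, norm1, ← Finset.add_sum_erase _ _ (Finset.mem_univ i),
      ← Finset.add_sum_erase _ _ (Finset.mem_univ i)]
    have : ∑ j ∈ Finset.univ.erase i,
        ((Function.update x i (x i - (x i - y i).sign) - y) j).natAbs
        = ∑ j ∈ Finset.univ.erase i, ((x - y) j).natAbs :=
      Finset.sum_congr rfl fun j hj => by simp [Function.update_of_ne (Finset.ne_of_mem_erase hj)]
    rw [this]
    simp only [Pi.sub_apply, Function.update_self]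
    rcases lt_or_gt_of_ne hi with h | h
    · rw [Int.sign_eq_neg_one_of_neg h]
      omega
    · rw [Int.sign_eq_one_of_pos h]
      omega

/-- Two lattice points are joined by a path whose number of edges is their `ℓ¹` distance. -/
lemma exists_isPath_length (x y : ZVec d) :
    ∃ l, IsPath d l ∧ l.head? = some x ∧ l.getLast? = some y ∧
      l.length = norm1 d (x - y) + 1 := by
  suffices H : ∀ m (x : ZVec d), norm1 d (x - y) = m → ∃ l, IsPath d l ∧ l.head? = some x ∧
      l.getLast? = some y ∧ l.length = m + 1 ∧ ∀ v ∈ l, norm1 d (v - y) ≤ m by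
    obtain ⟨l, h1, h2, h3, h4, -⟩ := H _ x rfl
    exact ⟨l, h1, h2, h3, h4⟩
  intro m
  induction m with
  | zero =>
    intro x hx
    obtain rfl : x = y := sub_eq_zero.1 (norm1_eq_zero hx)
    exact ⟨[x], ⟨by simp, by simp, chain'_iff_steps.2 (by simp)⟩, by simp, by simp, by simp,
      by simp [norm1]⟩
  | succ m ih =>
    intro x hx
    obtain ⟨z, hz, hzy⟩ := exists_adj_norm1_lt (x := x) (y := y) (by omega)
    obtain ⟨l, ⟨-, hnd, hch⟩, hh, hl, hlen, hle⟩ := ih z (by omega)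
    obtain ⟨t, rfl⟩ := exists_eq_cons_of_head? hh
    rw [chain'_iff_steps] at hch
    refine ⟨x :: z :: t, ⟨by simp, List.nodup_cons.2 ⟨fun h => ?_, hnd⟩,
      chain'_iff_steps.2 ?_⟩, rfl, by simpa using hl, by simpa using hlen, ?_⟩
    · have := hle x h
      omega
    · simp only [steps_cons_cons, List.mem_cons, forall_eq_or_imp]
      exact ⟨hz, hch⟩
    · simp only [List.mem_cons (a := _) (b := x), forall_eq_or_imp]
      exact ⟨hx.le, fun v hv => (hle v hv).trans m.le_succ⟩

end Norms

section Costs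

variable {d n : ℕ} {ω : Config d}

lemma EdgeOpen.symm {a b : ZVec d} (h : EdgeOpen d ω a b) : EdgeOpen d ω b a := by
  obtain ⟨e, he, ho⟩ := h
  exact ⟨e, he.symm, ho⟩

lemma pathCost_eq_sum (l : List (ZVec d)) :
    pathCost d n ω l = ((steps l).map fun p => pairWeight d n ω p.1 p.2).sum := by
  induction l with
  | nil => simp [pathCost]
  | cons a l ih => cases l <;> simp_all [pathCost]

lemma pairWeight_nonneg (a b : ZVec d) : 0 ≤ pairWeight d n ω a b := by
  unfold pairWeight
  split_ifs <;> positivity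

lemma pathCost_nonneg (l : List (ZVec d)) : 0 ≤ pathCost d n ω l := by
  rw [pathCost_eq_sum]
  refine List.sum_nonneg fun r hr => ?_
  obtain ⟨p, -, rfl⟩ := List.mem_map.1 hr
  exact pairWeight_nonneg _ _

lemma pathCost_le_of_sublist {l l' : List (ZVec d)} (h : (steps l').Sublist (steps l)) :
    pathCost d n ω l' ≤ pathCost d n ω l := by
  rw [pathCost_eq_sum, pathCost_eq_sum]
  refine (h.map _).sum_le_sum fun r hr => ?_
  obtain ⟨p, -, rfl⟩ := List.mem_map.1 hr
  exact pairWeight_nonneg _ _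

lemma pathCost_le_length {l : List (ZVec d)} (hl : l ≠ [])
    (h : ∀ p ∈ steps l, pairWeight d n ω p.1 p.2 ≤ 1) :
    pathCost d n ω l ≤ (l.length : ℝ) - 1 := by
  rw [pathCost_eq_sum]
  refine (List.sum_le_card_nsmul _ 1 ?_).trans ?_
  · intro r hr
    obtain ⟨p, hp, rfl⟩ := List.mem_map.1 hr
    exact h p hp
  · rw [List.length_map, length_steps, nsmul_one, Nat.cast_pred (List.length_pos_iff.2 hl)]

lemma mul_normInf_le_pathCost {w : ℝ} (hw : 0 ≤ w)
    (h : ∀ a b : ZVec d, w ≤ pairWeight d n ω a b) {a b : ZVec d} (l : List (ZVec d))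
    (hl : (a :: l ++ [b]).Chain' (Adj d)) :
    w * normInf d (a - b) ≤ pathCost d n ω (a :: l ++ [b]) := by
  have step {a c : ZVec d} (hac : Adj d a c) : w * normInf d (a - c) ≤ pairWeight d n ω a c := by
    have h1 : (normInf d (a - c) : ℝ) ≤ 1 := mod_cast hac.normInf_le
    nlinarith [h a c]
  rw [chain'_iff_steps] at hl
  induction l generalizing a with
  | nil =>
    simp only [List.singleton_append, steps_cons_cons, steps_singleton, List.mem_singleton,
      forall_eq] at hl
    simpa [pathCost] using step hl
  | cons c l ih =>
    simp only [List.cons_append, steps_cons_cons, List.mem_cons, forall_eq_or_imp] at hl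
    have h1 := ih (a := c) (by simpa using hl.2)
    have h2 := step hl.1
    have h3 : (normInf d (a - b) : ℝ) ≤ normInf d (a - c) + normInf d (c - b) :=
      mod_cast normInf_sub_le a c b
    simp only [List.cons_append, pathCost] at h1 ⊢
    nlinarith

lemma pathCost_append_append (A B : List (ZVec d)) {s : List (ZVec d)} {p q : ZVec d}
    (hp : s.head? = some p) (hq : s.getLast? = some q) :
    pathCost d n ω (A ++ s ++ B)
      = pathCost d n ω (A ++ [p]) + pathCost d n ω s + pathCost d n ω (q :: B) := by
  have h : (A ++ s).getLast? = some q := by simp [List.getLast?_append, hq]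
  simp only [pathCost_eq_sum, steps_append_of_getLast? B h, steps_append_of_head? A hp,
    List.map_append, List.sum_append]

lemma steps_append_append {α : Type*} (A B : List α) {s : List α} {p q : α}
    (hp : s.head? = some p) (hq : s.getLast? = some q) :
    steps (A ++ s ++ B) = steps (A ++ [p]) ++ steps s ++ steps (q :: B) := by
  have h : (A ++ s).getLast? = some q := by simp [List.getLast?_append, hq]
  rw [steps_append_of_getLast? B h, steps_append_of_head? A hp]

/-- A segment of a geodesic is a geodesic. -/
lemma IsGeodesicIn.pathCost_segment_le {A s B σ : List (ZVec d)} {p q : ZVec d}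
    (h : IsGeodesicIn d n ω Set.univ (A ++ s ++ B)) (hp : s.head? = some p)
    (hq : s.getLast? = some q) (hσ : IsPath d σ) (hσp : σ.head? = some p)
    (hσq : σ.getLast? = some q) :
    pathCost d n ω s ≤ pathCost d n ω σ := by
  have hne : A ++ σ ++ B ≠ [] := by simp [hσ.1]
  obtain ⟨l, hl, hnd, hh, hlast, -, hst⟩ := exists_loop_erasure hne
  have hch := chain'_iff_steps.1 h.1.2.2
  have hchσ := chain'_iff_steps.1 hσ.2.2
  rw [steps_append_append A B hp hq] at hch
  have hpath : IsPath d l := by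
    refine ⟨hl, hnd, chain'_iff_steps.2 fun r hr => ?_⟩
    have := hst.subset hr
    rw [steps_append_append A B hσp hσq] at this
    simp only [List.mem_append] at this hch
    rcases this with (h | h) | h
    · exact hch r (Or.inl (Or.inl h))
    · exact hchσ r h
    · exact hch r (Or.inr h)
  have h1 := h.2.2 l hpath (fun _ _ => Set.mem_univ _)
    (by rw [hh]; simp [List.head?_append, hp, hσp])
    (by rw [hlast]; simp [List.getLast?_append, hq, hσq])
  have h2 := h1.trans (pathCost_le_of_sublist hst)
  rw [pathCost_append_append A B hp hq, pathCost_append_append A B hσp hσq] at h2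
  linarith

end Costs

section Localization

variable {d n : ℕ} {ω : Config d}

lemma EdgeOpen.adj {a b : ZVec d} (h : EdgeOpen d ω a b) : Adj d a b := by
  obtain ⟨e, he | he, -⟩ := h
  · have := e.2.1
    rwa [he] at this
  · have := e.2.1
    rw [he] at this
    exact Adj.symm this

lemma pairWeight_of_edgeOpen {a b : ZVec d} (h : EdgeOpen d ω a b) :
    pairWeight d n ω a b = 1 := if_pos h

lemma pairWeight_bounds (hn : 2 ≤ n) :
    (∀ a b : ZVec d, 1 ≤ pairWeight d n ω a b) ∨
      ∀ a b : ZVec d, 0.48 ≤ pairWeight d n ω a b ∧ pairWeight d n ω a b ≤ 1 := by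
  rcases hn.eq_or_lt with rfl | hn
  · right
    intro a b
    have h1 := Real.log_two_gt_d9
    have h2 := Real.log_two_lt_d9
    unfold pairWeight
    split_ifs
    · norm_num
    · push_cast
      constructor <;> nlinarith
  · left
    intro a b
    have h1 : (1 : ℝ) ≤ Real.log n := by
      rw [Real.le_log_iff_exp_le (by positivity)]
      have h3 : (3 : ℝ) ≤ n := mod_cast hn
      linarith [Real.exp_one_lt_d9]
    unfold pairWeight
    split_ifs
    · exact le_rfl
    · nlinarith

/-- Adjacency by an open edge inside `U`. -/
def OpenAdjIn (ω : Config d) (U : Set (ZVec d)) (a b : ZVec d) : Prop :=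
  EdgeOpen d ω a b ∧ a ∈ U ∧ b ∈ U

lemma OpenAdjIn.symm {U : Set (ZVec d)} {a b : ZVec d} (h : OpenAdjIn ω U a b) :
    OpenAdjIn ω U b a :=
  ⟨h.1.symm, h.2.2, h.2.1⟩

lemma exists_openPath_of_reflTransGen {U : Set (ZVec d)} {a b : ZVec d} (ha : a ∈ U)
    (h : Relation.ReflTransGen (OpenAdjIn ω U) a b) :
    ∃ l, IsPath d l ∧ IsOpenPath d ω l ∧ (∀ v ∈ l, v ∈ U) ∧
      l.head? = some a ∧ l.getLast? = some b := by
  obtain ⟨t, ht, hb⟩ := List.exists_isChain_cons_of_relationReflTransGen h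
  obtain ⟨l, hl, hnd, hh, hlast, hsub, hst⟩ := exists_loop_erasure (List.cons_ne_nil a t)
  have hch := chain'_iff_steps.1 ht
  refine ⟨l, ⟨hl, hnd, chain'_iff_steps.2 fun p hp => (hch p (hst.subset hp)).1.adj⟩,
    chain'_iff_steps.2 fun p hp => (hch p (hst.subset hp)).1, fun v hv => ?_, by simp [hh], ?_⟩
  · have : ∀ s u, u ∈ U → (∀ p ∈ steps (u :: s), OpenAdjIn ω U p.1 p.2) → ∀ v ∈ u :: s, v ∈ U := by
      intro s
      induction s with
      | nil => simp
      | cons c s ih =>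
        intro u hu hs v hv
        simp only [steps_cons_cons, List.mem_cons, forall_eq_or_imp] at hs
        rcases List.mem_cons.1 hv with rfl | hv
        · exact hu
        · exact ih c hs.1.2.2 hs.2 v hv
    exact this t a ha hch v (hsub v hv)
  · rw [hlast, List.getLast?_eq_some_getLast (List.cons_ne_nil a t), hb]

/-- Along a geodesic, the stretch between two openly connected points of `Λ_{3N}(e)` stays in
`Λ_{C_* N}(e)`. -/
lemma IsGeodesicIn.mem_boxR_between (hd : 2 ≤ d) (hn : 2 ≤ n) {C : ℝ} (hC : 1 + 99 * d ≤ C)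
    {e : EdgeD d} {N : ℕ} (hN : 1 ≤ N) (hV : V2 d C e N ω) {A B : List (ZVec d)}
    {k p q : ZVec d} (hg : IsGeodesicIn d n ω Set.univ (A ++ k :: B)) (hp : p ∈ A) (hq : q ∈ B)
    (hpU : p ∈ boxZ d (3 * N) e.val.1) (hqU : q ∈ boxZ d (3 * N) e.val.1)
    (hpq : Relation.ReflTransGen (OpenAdjIn ω (boxZ d (3 * N) e.val.1)) p q) :
    k ∈ boxR d (C * N) e.val.1 := by
  obtain ⟨A₁, A₂, rfl⟩ := List.append_of_mem hp
  obtain ⟨B₁, B₂, rfl⟩ := List.append_of_mem hq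
  set z := e.val.1
  have hsplit : A₁ ++ p :: A₂ ++ k :: (B₁ ++ q :: B₂)
      = A₁ ++ (p :: A₂ ++ [k] ++ (B₁ ++ [q])) ++ B₂ := by simp
  rw [hsplit] at hg
  have hh : (p :: A₂ ++ [k] ++ (B₁ ++ [q])).head? = some p := by simp
  have hl : (p :: A₂ ++ [k] ++ (B₁ ++ [q])).getLast? = some q := by
    rw [← List.append_assoc, List.getLast?_append]
    simp
  have hmin := fun σ => hg.pathCost_segment_le (σ := σ) hh hl
  have hcost := pathCost_append_append (n := n) (ω := ω) (p :: A₂) (B₁ ++ [q]) (s := [k])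
    (p := k) (q := k) (by simp) (by simp)
  have hch1 : (p :: A₂ ++ [k]).Chain' (Adj d) :=
    List.IsChain.infix hg.1.2.2 ⟨A₁, B₁ ++ [q] ++ B₂, by simp⟩
  have hch2 : (k :: B₁ ++ [q]).Chain' (Adj d) :=
    List.IsChain.infix hg.1.2.2 ⟨A₁ ++ p :: A₂, B₂, by simp⟩
  have hk0 : pathCost d n ω [k] = 0 := rfl
  rw [hk0, add_zero] at hcost
  have hN' : (1 : ℝ) ≤ N := mod_cast hN
  have hd' : (2 : ℝ) ≤ d := mod_cast hd
  have hpU' : normInf d (p - z) ≤ 3 * N := hpU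
  have hqU' : normInf d (q - z) ≤ 3 * N := hqU
  have hpR : (normInf d (p - z) : ℝ) ≤ 3 * N := mod_cast hpU'
  have hqR : (normInf d (q - z) : ℝ) ≤ 3 * N := mod_cast hqU'
  have t1 : (normInf d (k - z) : ℝ) ≤ normInf d (p - k) + normInf d (p - z) := by
    rw [normInf_sub_comm p k]
    exact mod_cast normInf_sub_le k p z
  have t2 : (normInf d (k - z) : ℝ) ≤ normInf d (k - q) + normInf d (q - z) :=
    mod_cast normInf_sub_le k q z
  change (normInf d (k - z) : ℝ) ≤ C * N
  rcases pairWeight_bounds (ω := ω) hn with hw | hw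
  · obtain ⟨σ, hσ, hσo, -, hσh, hσl, hσN⟩ :=
      hV p q hpU hqU (exists_openPath_of_reflTransGen hpU hpq)
    have h1 := hmin σ hσ hσh hσl
    have h2 := pathCost_le_length (n := n) (ω := ω) hσ.1 fun r hr =>
      (pairWeight_of_edgeOpen (n := n) (chain'_iff_steps.1 hσo r hr)).le
    have l1 := mul_normInf_le_pathCost zero_le_one hw A₂ hch1
    have l2 := mul_normInf_le_pathCost zero_le_one hw B₁ hch2
    simp only [List.cons_append] at hcost l1 l2 h1
    nlinarith
  · obtain ⟨σ, hσ, hσh, hσl, hσN⟩ := exists_isPath_length p q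
    have h1 := hmin σ hσ hσh hσl
    have h2 := pathCost_le_length (n := n) (ω := ω) hσ.1 fun r _ => (hw r.1 r.2).2
    have l1 := mul_normInf_le_pathCost (by norm_num) (fun a b => (hw a b).1) A₂ hch1
    have l2 := mul_normInf_le_pathCost (by norm_num) (fun a b => (hw a b).1) B₁ hch2
    have h3 : norm1 d (p - q) ≤ d * (6 * N) := by
      refine (norm1_le_mul_normInf _).trans (Nat.mul_le_mul_left _ ?_)
      have := normInf_sub_le p z q
      rw [normInf_sub_comm z q] at this
      omega
    have h4 : (norm1 d (p - q) : ℝ) ≤ d * (6 * N) := mod_cast h3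
    have h5 : (1 + 99 * d : ℝ) * N ≤ C * N := by gcongr
    have h6 : (2 : ℝ) * N ≤ d * N := by gcongr
    rw [hσN] at h2
    push_cast at h2
    simp only [List.cons_append] at hcost l1 l2 h1
    nlinarith

lemma forall_or_forall_not_of_steps {α : Type*} {Q : α → Prop} {l : List α}
    (h : ∀ p ∈ steps l, (Q p.1 ↔ Q p.2)) : (∀ v ∈ l, Q v) ∨ ∀ v ∈ l, ¬ Q v := by
  induction l with
  | nil => simp
  | cons a l ih =>
    cases l with
    | nil => simpa using em (Q a)
    | cons b l =>
      simp only [steps_cons_cons, List.mem_cons, forall_eq_or_imp] at h ih ⊢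
      have := ih h.2
      tauto

/-- A path in `Λ_{3N}(e)` using open edges and edges of a geodesic meets the geodesic on one side
only of any geodesic point outside `Λ_{C_* N}(e)`. -/
lemma IsGeodesicIn.meets_one_side (hd : 2 ≤ d) (hn : 2 ≤ n) {C : ℝ} (hC : 1 + 99 * d ≤ C)
    {e : EdgeD d} {N : ℕ} (hN : 1 ≤ N) (hV : V2 d C e N ω) {A B : List (ZVec d)}
    {k : ZVec d} (hg : IsGeodesicIn d n ω Set.univ (A ++ k :: B))
    (hk : k ∉ boxR d (C * N) e.val.1) {l : List (ZVec d)}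
    (hl : ∀ v ∈ l, v ∈ boxZ d (3 * N) e.val.1)
    (hedge : ∀ p ∈ steps l, edgeMemPath d p.1 p.2 (A ++ k :: B) ∨ EdgeOpen d ω p.1 p.2) :
    (∀ v ∈ l, v ∈ A ++ k :: B → v ∈ A) ∨ (∀ v ∈ l, v ∈ A ++ k :: B → v ∈ B) := by
  set U := boxZ d (3 * N) e.val.1
  have hkU : k ∉ U := by
    intro h
    apply hk
    have h1 : normInf d (k - e.val.1) ≤ 3 * N := h
    have h2 : (normInf d (k - e.val.1) : ℝ) ≤ 3 * N := mod_cast h1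
    have hd' : (2 : ℝ) ≤ d := mod_cast hd
    refine h2.trans ?_
    gcongr
    linarith
  have hside {w : ZVec d} (hw : w ∈ A ++ k :: B) (hwU : w ∈ U) : w ∈ A ∨ w ∈ B := by
    have : w ≠ k := fun h => hkU (h ▸ hwU)
    simpa [this] using hw
  have hsep {a b : ZVec d} (ha : a ∈ A) (hb : b ∈ B) (haU : a ∈ U) (hbU : b ∈ U) :
      ¬ Relation.ReflTransGen (OpenAdjIn ω U) a b := fun h =>
    hk (hg.mem_boxR_between hd hn hC hN hV ha hb haU hbU h)
  have hdisj {w : ZVec d} (ha : w ∈ A) (hb : w ∈ B) : False :=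
    (List.nodup_append.1 hg.1.2.1).2.2 w ha w (List.mem_cons_of_mem _ hb) rfl
  let Q : ZVec d → Prop := fun v =>
    ∀ w ∈ A ++ k :: B, w ∈ U → Relation.ReflTransGen (OpenAdjIn ω U) v w → w ∈ A
  have hQ {v : ZVec d} (hv : v ∈ A ++ k :: B) (hvU : v ∈ U) : Q v ↔ v ∈ A := by
    refine ⟨fun h => h v hv hvU .refl, fun h w hw hwU hvw => ?_⟩
    exact (hside hw hwU).resolve_right fun hwB => hsep h hwB hvU hwU hvw
  have hstepA {a b : ZVec d} (h : (a, b) ∈ steps (A ++ k :: B)) (haU : a ∈ U) (hbU : b ∈ U) :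
      a ∈ A ↔ b ∈ A := by
    rw [steps_append_cons, List.mem_append] at h
    have hbk : b ≠ k := fun h => hkU (h ▸ hbU)
    have hak : a ≠ k := fun h => hkU (h ▸ haU)
    rcases h with h | h
    · have := mem_of_mem_steps h
      simp only [List.mem_append, List.mem_singleton, hbk, hak, or_false] at this
      tauto
    · have := mem_of_mem_steps h
      simp only [List.mem_cons, hbk, hak, false_or] at this
      exact ⟨fun h => (hdisj h this.1).elim, fun h => (hdisj h this.2).elim⟩
  have hinv : ∀ p ∈ steps l, (Q p.1 ↔ Q p.2) := by
    intro p hp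
    have h1 := hl _ (mem_of_mem_steps hp).1
    have h2 := hl _ (mem_of_mem_steps hp).2
    rcases hedge p hp with (h | h) | h
    · rw [hQ (mem_of_mem_steps h).1 h1, hQ (mem_of_mem_steps h).2 h2]
      exact hstepA h h1 h2
    · rw [hQ (mem_of_mem_steps h).2 h1, hQ (mem_of_mem_steps h).1 h2]
      exact (hstepA h h2 h1).symm
    · have hr : OpenAdjIn ω U p.1 p.2 := ⟨h, h1, h2⟩
      exact ⟨fun hq w hw hwU h => hq w hw hwU (h.head hr),
        fun hq w hw hwU h => hq w hw hwU (h.head hr.symm)⟩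
  refine (forall_or_forall_not_of_steps hinv).imp (fun h v hv hvg => ?_) fun h v hv hvg => ?_
  · exact (hQ hvg (hl v hv)).1 (h v hv)
  · exact (hside hvg (hl v hv)).resolve_left fun hA => h v hv ((hQ hvg (hl v hv)).2 hA)

lemma IsPath.infix {l m : List (ZVec d)} (hl : IsPath d l) (h : m <:+: l) (hm : m ≠ []) :
    IsPath d m :=
  ⟨hm, hl.2.1.sublist h.sublist, List.IsChain.infix hl.2.2 h⟩

/-- A stretch of a modified geodesic inside `Λ_{3N}(e)` is a modified geodesic of the box
`Λ_{C_* N}(e)`. -/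
lemma GstarIn.localize (hd : 2 ≤ d) (hn : 2 ≤ n) {C : ℝ} (hC : 1 + 99 * d ≤ C)
    {e : EdgeD d} {N : ℕ} (hN : 1 ≤ N) (hV : V2 d C e N ω) {γ l : List (ZVec d)}
    (hγ : GstarIn d n ω Set.univ γ) (hlγ : l <:+: γ) (hne : l ≠ [])
    (hl : ∀ v ∈ l, v ∈ boxZ d (3 * N) e.val.1) :
    GstarIn d n ω (boxR d (C * N) e.val.1) l := by
  obtain ⟨hpath, -, π, hπ, hopen⟩ := hγ
  have hbox : ∀ v ∈ l, v ∈ boxR d (C * N) e.val.1 := by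
    intro v hv
    have h1 : normInf d (v - e.val.1) ≤ 3 * N := hl v hv
    have h2 : (normInf d (v - e.val.1) : ℝ) ≤ 3 * N := mod_cast h1
    have hd' : (2 : ℝ) ≤ d := mod_cast hd
    refine h2.trans ?_
    gcongr
    linarith
  have hmemγ {a b : ZVec d} (h : edgeMemPath d a b l) : edgeMemPath d a b γ :=
    h.imp (mem_steps_of_infix hlγ) (mem_steps_of_infix hlγ)
  have hmeml {a b : ZVec d} (h : edgeMemPath d a b l) : a ∈ l ∧ b ∈ l :=
    h.elim mem_of_mem_steps fun h => (mem_of_mem_steps h).symm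
  refine ⟨hpath.infix hlγ hne, hbox, ?_⟩
  by_cases hW : ∃ v ∈ π, v ∈ l
  · obtain ⟨A, m, B, a, b, rfl, ha, hb, hal, hbl, hA, hB⟩ := exists_hull_split hW
    have hminf : m <:+: A ++ m ++ B := ⟨A, B, rfl⟩
    have hmne : m ≠ [] := by
      rintro rfl
      simp at ha
    refine ⟨m, ⟨hπ.1.infix hminf hmne, fun k hk => ?_, fun σ hσ _ hσh hσl =>
      hπ.pathCost_segment_le ha hb hσ (hσh.trans ha) (hσl.trans hb)⟩, fun u v huv hm => ?_⟩
    · by_contra hkbox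
      obtain ⟨s, t, rfl⟩ := List.append_of_mem hk
      have hak : a ≠ k := fun h => hkbox (h ▸ hbox a hal)
      have hbk : b ≠ k := fun h => hkbox (h ▸ hbox b hbl)
      have has : a ∈ s := by
        cases s <;> simp_all
      have hbt : b ∈ t := by
        rw [List.getLast?_append] at hb
        rcases t.eq_nil_or_concat with rfl | ⟨t, c, rfl⟩
        · simp_all
        · simp only [List.concat_eq_append] at hb ⊢
          rw [← List.cons_append, List.getLast?_append] at hb
          simp_all
      have heq : A ++ (s ++ k :: t) ++ B = (A ++ s) ++ k :: (t ++ B) := by simp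
      rw [heq] at hπ hopen
      have hnd := (List.nodup_append.1 hπ.1.2.1).2.2
      rcases hπ.meets_one_side hd hn hC hN hV hkbox hl fun p hp => by
        by_cases h : edgeMemPath d p.1 p.2 ((A ++ s) ++ k :: (t ++ B))
        · exact Or.inl h
        · exact Or.inr (hopen _ _ (hmemγ (Or.inl hp)) h) with h | h
      · exact hnd b (h b hbl (by simp [hbt])) b (by simp [hbt]) rfl
      · exact hnd a (by simp [has]) a (List.mem_cons_of_mem _ (h a hal (by simp [has]))) rfl
    · obtain ⟨hu, hv⟩ := hmeml huv
      refine hopen u v (hmemγ huv) fun hπe => hm ?_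
      have key {u v : ZVec d} (hu : u ∈ l) (hv : v ∈ l) (h : (u, v) ∈ steps (A ++ m ++ B)) :
          (u, v) ∈ steps m := by
        rw [steps_append_append A B ha hb, List.mem_append, List.mem_append] at h
        rcases h with (h | h) | h
        · exact absurd hu (hA _ (fst_mem_of_mem_steps_concat h))
        · exact h
        · exact absurd hv (hB _ (snd_mem_of_mem_steps_cons h))
      exact hπe.imp (key hu hv) (key hv hu)
  · obtain ⟨c, t, rfl⟩ := List.exists_cons_of_ne_nil hne
    refine ⟨[c], ⟨⟨by simp, by simp, chain'_iff_steps.2 (by simp)⟩, by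
      simpa using hbox c (by simp), fun σ _ _ _ _ => pathCost_nonneg σ⟩, fun u v huv _ => ?_⟩
    refine hopen u v (hmemγ huv) fun h => hW ⟨u, ?_, (hmeml huv).1⟩
    exact h.elim (fun h => (mem_of_mem_steps h).1) fun h => (mem_of_mem_steps h).2

end Localization

section Bypass

variable {d n : ℕ} {ω : Config d}

/-- A path from outside `Λ_{3N}(e)` to the first point in `Λ_N(e)` ends with a crossing of the
annulus. -/
lemma exists_crossing_suffix {e : EdgeD d} {N : ℕ} (hN : 1 ≤ N) {L : List (ZVec d)} {h : ZVec d}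
    (hch : ∀ p ∈ steps (L ++ [h]), Adj d p.1 p.2)
    (hout : ∃ c ∈ L, 3 * N < normInf d (c - e.val.1))
    (hL : ∀ v ∈ L, N < normInf d (v - e.val.1)) (hh : normInf d (h - e.val.1) ≤ N) :
    ∃ A M, L = A ++ M ∧ M ≠ [] ∧ (∀ v ∈ M, v ∈ annulus d N e) ∧
      (∃ v ∈ M, normInf d (v - e.val.1) = N + 1) ∧
      ∃ v ∈ M, normInf d (v - e.val.1) = 3 * N := by
  obtain ⟨A, c, M, rfl, hc, hM⟩ := exists_last_split hout
  cases M with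
  | nil =>
    have := (hch (c, h)
      (mem_steps_of_infix (m := [c, h]) ⟨A, [], by simp⟩ (by simp))).normInf_sub_le e.val.1
    simp only at this
    omega
  | cons b M =>
    obtain ⟨t, q, hq⟩ : ∃ t q, b :: M = t ++ [q] :=
      ⟨_, _, (List.dropLast_append_getLast (List.cons_ne_nil b M)).symm⟩
    have hcb := (hch (c, b)
      (mem_steps_of_infix (m := [c, b]) ⟨A, M ++ [h], by simp⟩ (by simp))).normInf_sub_le e.val.1
    have hqh : Adj d q h := hch (q, h) (by
      rw [hq]
      refine mem_steps_of_infix (m := [q, h]) ⟨A ++ c :: t, [], by simp⟩ (by simp))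
    have hqh := hqh.normInf_sub_le e.val.1
    have hqM : q ∈ b :: M := hq ▸ by simp
    have hbM := hM b (by simp)
    have hqL := hL q (List.mem_append_right _ (List.mem_cons_of_mem _ hqM))
    refine ⟨A ++ [c], b :: M, by simp, by simp, fun v hv => ⟨not_lt.1 (hM v hv), hL v ?_⟩,
      ⟨q, hqM, by omega⟩, ⟨b, by simp, by simp only at hcb; omega⟩⟩
    exact List.mem_append_right _ (List.mem_cons_of_mem _ hv)

/-- A list from `P` to `S` contains a stretch meeting `P` and `S` only at its extremities. -/
lemma exists_linking_segment {α : Type*} {P S l : List α} (hPS : ∀ v ∈ P, v ∉ S)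
    (hu : ∃ u, l.head? = some u ∧ u ∈ P) (hv : ∃ v, l.getLast? = some v ∧ v ∈ S) :
    ∃ u μ v, u ∈ P ∧ v ∈ S ∧ u :: μ ++ [v] <:+: l ∧ ∀ w ∈ μ, w ∉ P ∧ w ∉ S := by
  obtain ⟨u₀, hu₀, hu₀P⟩ := hu
  obtain ⟨v₀, hv₀, hv₀S⟩ := hv
  obtain ⟨A, u, M, rfl, hu, hM⟩ :=
    exists_last_split (P := (· ∈ P)) ⟨u₀, List.mem_of_mem_head? hu₀, hu₀P⟩
  have hv₀M : v₀ ∈ M := by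
    have : v₀ ≠ u := fun h => hPS u hu (h ▸ hv₀S)
    rw [List.getLast?_append] at hv₀
    rcases M.eq_nil_or_concat with rfl | ⟨t, c, rfl⟩
    · simp_all
    · simp only [List.concat_eq_append] at hv₀ ⊢
      rw [← List.cons_append, List.getLast?_append] at hv₀
      simp_all
  obtain ⟨μ, v, B, rfl, hv, hμ⟩ := exists_first_split (P := (· ∈ S)) ⟨v₀, hv₀M, hv₀S⟩
  exact ⟨u, μ, v, hu, hv, ⟨A, B, by simp⟩, fun w hw => ⟨hM w (by simp [hw]), hμ w hw⟩⟩

lemma edgeMemPath.mem {a b : ZVec d} {l : List (ZVec d)} (h : edgeMemPath d a b l) :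
    a ∈ l ∧ b ∈ l :=
  h.elim mem_of_mem_steps fun h => (mem_of_mem_steps h).symm

/-- A modified geodesic that enters and leaves `Λ_N(e)` can be rerouted through the annulus
`A_N(e)`. -/
lemma GstarIn.exists_bypass (hd : 2 ≤ d) (hn : 2 ≤ n) {C : ℝ} (hC : 1 + 99 * d ≤ C)
    {e : EdgeD d} {N : ℕ} (hN : 1 ≤ N) (hV1 : V1 d C n e N ω) (hV2 : V2 d C e N ω)
    {x y : ZVec d} {γ : List (ZVec d)} (hγ : GstarIn d n ω Set.univ γ)
    (hhead : γ.head? = some x) (hlast : γ.getLast? = some y)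
    (he : ∃ v ∈ γ, v ∈ boxZ d N e.val.1)
    (hx : x ∉ boxZ d (3 * N) e.val.1) (hy : y ∉ boxZ d (3 * N) e.val.1) :
    ∃ η : List (ZVec d), GstarIn d n ω Set.univ η ∧
      η.head? = some x ∧ η.getLast? = some y ∧
      (∀ v ∈ η, v ∉ boxZ d N e.val.1) ∧
      (∀ a b : ZVec d, edgeMemPath d a b η → ¬ edgeMemPath d a b γ →
        EdgeOpen d ω a b ∧ a ∈ annulus d N e ∧ b ∈ annulus d N e) ∧
      (diffEdgeCount d η γ : ℝ) ≤ C * N := by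
  have hx' : 3 * N < normInf d (x - e.val.1) := not_le.1 hx
  have hy' : 3 * N < normInf d (y - e.val.1) := not_le.1 hy
  obtain ⟨P, m, S, a, b, rfl, ha, hb, haN, hbN, hP, hS⟩ := exists_hull_split he
  replace haN : normInf d (a - e.val.1) ≤ N := haN
  replace hbN : normInf d (b - e.val.1) ≤ N := hbN
  have hP' : ∀ v ∈ P, N < normInf d (v - e.val.1) := fun v hv => not_le.1 (hP v hv)
  have hS' : ∀ v ∈ S, N < normInf d (v - e.val.1) := fun v hv => not_le.1 (hS v hv)
  have hxP : P.head? = some x := by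
    cases P with
    | nil =>
      rw [List.nil_append, List.head?_append, ha] at hhead
      obtain rfl : a = x := by simpa using hhead
      omega
    | cons c P => simpa using hhead
  have hyS : S.getLast? = some y := by
    rcases S.eq_nil_or_concat with rfl | ⟨t, c, rfl⟩
    · rw [List.append_nil, List.getLast?_append, hb] at hlast
      obtain rfl : b = y := by simpa using hlast
      omega
    · simpa using hlast
  have hch := chain'_iff_steps.1 hγ.1.2.2
  have hsteps := steps_append_append P S ha hb
  obtain ⟨P₀, γ₁, hPγ₁, hγ₁ne, hγ₁A, hγ₁in, hγ₁out⟩ := exists_crossing_suffix (e := e) hN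
    (L := P) (h := a) (fun p hp => hch p (by rw [hsteps]; simp [hp]))
    ⟨x, List.mem_of_mem_head? hxP, hx'⟩ hP' haN
  obtain ⟨S₀, γ₂, hSγ₂, hγ₂ne, hγ₂A, hγ₂in, hγ₂out⟩ := exists_crossing_suffix (e := e) hN
    (L := S.reverse) (h := b) (fun p hp => by
      rw [← List.reverse_cons] at hp
      have := steps_reverse_swap.1 hp
      exact (hch (p.2, p.1) (by rw [hsteps]; simp [this])).symm)
    ⟨y, by simpa using List.mem_of_getLast? hyS, hy'⟩ (by simpa using hS') hbN
  have hSγ₂' : S = γ₂.reverse ++ S₀.reverse := by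
    rw [← List.reverse_reverse S, hSγ₂, List.reverse_append]
  have hinf₁ : γ₁ <:+: P ++ m ++ S := ⟨P₀, m ++ S, by simp [hPγ₁]⟩
  have hinf₂ : γ₂.reverse <:+: P ++ m ++ S := ⟨P ++ m, S₀.reverse, by simp [hSγ₂']⟩
  have hγ₂ne' : γ₂.reverse ≠ [] := by simpa using hγ₂ne
  obtain ⟨l, hl, hlo, hlA, hlu, hlv, hlN⟩ := hV1 γ₁ γ₂.reverse
    (hγ.localize hd hn hC hN hV2 hinf₁ hγ₁ne fun v hv => (hγ₁A v hv).1)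
    ⟨hγ.1.infix hinf₁ hγ₁ne, hγ₁A, hγ₁in, hγ₁out⟩
    (hγ.localize hd hn hC hN hV2 hinf₂ hγ₂ne' fun v hv => (hγ₂A v (by simpa using hv)).1)
    ⟨hγ.1.infix hinf₂ hγ₂ne', fun v hv => hγ₂A v (by simpa using hv),
      by simpa using hγ₂in, by simpa using hγ₂out⟩
  have hnd := hγ.1.2.1
  have hPS : ∀ v ∈ P, v ∉ S := fun v hv hvS =>
    (List.nodup_append.1 hnd).2.2 v (by simp [hv]) v hvS rfl
  obtain ⟨u, μ, v, huP, hvS, hμl, hμ⟩ := exists_linking_segment (l := l) hPS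
    (hlu.imp fun u hu => ⟨hu.1, hPγ₁ ▸ List.mem_append_right _ hu.2⟩)
    (hlv.imp fun v hv => ⟨hv.1, hSγ₂' ▸ List.mem_append_left _ hv.2⟩)
  obtain ⟨P₁, P₂, rfl⟩ := List.append_of_mem huP
  obtain ⟨S₁, S₂, rfl⟩ := List.append_of_mem hvS
  set γ := P₁ ++ u :: P₂ ++ m ++ (S₁ ++ v :: S₂) with hγdef
  set η := P₁ ++ (u :: μ ++ [v]) ++ S₂ with hη
  have hηsteps : steps η = steps (P₁ ++ [u]) ++ steps (u :: μ ++ [v]) ++ steps (v :: S₂) :=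
    steps_append_append P₁ S₂ (by simp) List.getLast?_concat
  have hpre : ∀ p ∈ steps (P₁ ++ [u]), p ∈ steps γ := fun p hp =>
    mem_steps_of_infix ⟨[], P₂ ++ m ++ (S₁ ++ v :: S₂), by simp [hγdef]⟩ hp
  have hsuf : ∀ p ∈ steps (v :: S₂), p ∈ steps γ := fun p hp =>
    mem_steps_of_infix ⟨P₁ ++ u :: P₂ ++ m ++ S₁, [], by simp [hγdef]⟩ hp
  have hηcases : ∀ p ∈ steps η, p ∈ steps γ ∨ p ∈ steps l := by
    intro p hp
    rw [hηsteps, List.mem_append, List.mem_append] at hp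
    rcases hp with (hp | hp) | hp
    · exact Or.inl (hpre p hp)
    · exact Or.inr (mem_steps_of_infix hμl hp)
    · exact Or.inl (hsuf p hp)
  have hηmem {a b : ZVec d} (h : edgeMemPath d a b η) (hab : ¬ edgeMemPath d a b γ) :
      edgeMemPath d a b l := by
    rcases h with h | h
    · exact Or.inl ((hηcases _ h).resolve_left fun h => hab (Or.inl h))
    · exact Or.inr ((hηcases _ h).resolve_left fun h => hab (Or.inr h))
  have hlopen {a b : ZVec d} (h : edgeMemPath d a b l) : EdgeOpen d ω a b :=
    h.elim (fun h => chain'_iff_steps.1 hlo _ h) fun h => (chain'_iff_steps.1 hlo _ h).symm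
  have hchl := chain'_iff_steps.1 hl.2.2
  have hμnd : (u :: μ ++ [v]).Nodup := hl.2.1.sublist hμl.sublist
  have hηpath : IsPath d η := by
    refine ⟨by simp [hη], ?_, chain'_iff_steps.2 fun p hp =>
      (hηcases p hp).elim (hch p) (hchl p)⟩
    have hμnd' : μ.Nodup := hμnd.sublist
      (((List.sublist_append_left μ [v])).trans (List.sublist_cons_self u _))
    have hPnd : (P₁ ++ [u]).Nodup :=
      hnd.sublist (List.IsInfix.sublist ⟨[], P₂ ++ m ++ (S₁ ++ v :: S₂), by simp [hγdef]⟩)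
    have hSnd : (v :: S₂).Nodup :=
      hnd.sublist (List.IsInfix.sublist ⟨P₁ ++ u :: P₂ ++ m ++ S₁, [], by simp [hγdef]⟩)
    have hη' : η = (P₁ ++ [u]) ++ (μ ++ v :: S₂) := by simp [hη]
    have hPsub : ∀ w ∈ P₁ ++ [u], w ∈ P₁ ++ u :: P₂ := by
      intro w hw
      simp at hw ⊢
      tauto
    have hSsub : ∀ w ∈ v :: S₂, w ∈ S₁ ++ v :: S₂ := fun w hw => List.mem_append_right _ hw
    rw [hη', List.nodup_append]
    refine ⟨hPnd, List.nodup_append.2 ⟨hμnd', hSnd, ?_⟩, ?_⟩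
    · rintro w hw _ hw' rfl
      exact (hμ w hw).2 (hSsub w hw')
    · rintro w hw _ hw' rfl
      rcases List.mem_append.1 hw' with hw' | hw'
      · exact (hμ w hw').1 (hPsub w hw)
      · exact hPS w (hPsub w hw) (hSsub w hw')
  refine ⟨η, ⟨hηpath, fun _ _ => Set.mem_univ _, ?_⟩, ?_, ?_, ?_, ?_, ?_⟩
  · obtain ⟨-, -, π, hπ, hopen⟩ := hγ
    refine ⟨π, hπ, fun a b hab hπab => ?_⟩
    by_cases h : edgeMemPath d a b γ
    · exact hopen a b h hπab
    · exact hlopen (hηmem hab h)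
  · rw [← hxP]
    cases P₁ <;> simp [hη]
  · rw [← hyS]
    simp [hη, List.getLast?_append, List.getLast?_cons]
  · intro w hw
    have hw' : w ∈ P₁ ++ u :: P₂ ∨ w ∈ μ ∨ w ∈ S₁ ++ v :: S₂ := by
      simp [hη] at hw ⊢
      tauto
    rcases hw' with hw | hw | hw
    · exact hP w hw
    · exact not_le.2 (hlA w (hμl.subset (by simp [hw]))).2
    · exact hS w hw
  · intro a b hab hγab
    have h := hηmem hab hγab
    exact ⟨hlopen h, hlA _ h.mem.1, hlA _ h.mem.2⟩
  · have hcount : diffEdgeCount d η γ ≤ l.length - 1 := by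
      change ((steps η).filter _).length ≤ _
      have hnil {s : List (ZVec d × ZVec d)} (hs : ∀ p ∈ s, p ∈ steps γ) :
          s.filter (fun p => decide (¬ edgeMemPath d p.1 p.2 γ)) = [] :=
        List.filter_eq_nil_iff.2 fun p hp => by
          have : edgeMemPath d p.1 p.2 γ := Or.inl (hs p hp)
          simpa using this
      rw [hηsteps, List.filter_append, List.filter_append, hnil hpre, hnil hsuf,
        List.nil_append, List.append_nil]
      refine (List.length_filter_le _ _).trans ?_
      rw [length_steps]
      exact Nat.sub_le_sub_right hμl.length_le 1
    have h1 : (diffEdgeCount d η γ : ℝ) ≤ ((l.length - 1 : ℕ) : ℝ) := mod_cast hcount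
    rw [Nat.cast_pred (List.length_pos_iff.2 hl.1)] at h1
    exact h1.trans hlN

end Bypass

/-- Proposition 2.5: bypass construction via the effective radius.
If `γ ∈ 𝔾_*(x,y)` and `e` is an edge of `γ` with `x, y ∉ Λ_{3R_e}(e)`, then there is a
path `η_e ∈ 𝔾_*(x,y)` with (i) `η_e ∩ Λ_{R_e}(e) = ∅` and `η_e \ γ` open and contained
in the annulus `A_{R_e}(e)`, and (ii) `|η_e \ γ| ≤ C_* R_e`. -/
theorem bypass_construction_effective_radius
    (d n : ℕ) (hd : 2 ≤ d) (hn : 2 ≤ n)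
    (ρ cs Cstar : ℝ) (hρ : 1 ≤ ρ) (hcs0 : 0 < cs) (hcs1 : cs < 1)
    (hC : Cstar = 1 / cs + (100 * ρ ^ 2) ^ d)
    (ω : Config d) (x y : ZVec d) (γ : List (ZVec d))
    (hγ : GstarIn d n ω Set.univ γ) (hhead : γ.head? = some x) (hlast : γ.getLast? = some y)
    (e : EdgeD d) (he : edgeMemPath d e.val.1 e.val.2 γ)
    (hfin : ∃ N : ℕ, 1 ≤ N ∧ V1 d Cstar n e N ω ∧ V2 d Cstar e N ω)
    (hx : x ∉ boxZ d (3 * ReffN d Cstar n e ω) e.val.1)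
    (hy : y ∉ boxZ d (3 * ReffN d Cstar n e ω) e.val.1) :
    ∃ η : List (ZVec d), GstarIn d n ω Set.univ η ∧
      η.head? = some x ∧ η.getLast? = some y ∧
      (∀ v ∈ η, v ∉ boxZ d (ReffN d Cstar n e ω) e.val.1) ∧
      (∀ a b : ZVec d, edgeMemPath d a b η → ¬ edgeMemPath d a b γ →
        EdgeOpen d ω a b ∧ a ∈ annulus d (ReffN d Cstar n e ω) e ∧
        b ∈ annulus d (ReffN d Cstar n e ω) e) ∧
      (diffEdgeCount d η γ : ℝ) ≤ Cstar * ReffN d Cstar n e ω := by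
  obtain ⟨hN, hV1, hV2⟩ := Nat.sInf_mem (s := {N : ℕ | 1 ≤ N ∧ V1 d Cstar n e N ω ∧
    V2 d Cstar e N ω}) hfin
  have hC' : (1 + 99 * d : ℝ) ≤ Cstar := by
    have h1 : (100 : ℝ) ^ d ≤ (100 * ρ ^ 2) ^ d := by
      gcongr
      nlinarith
    have h2 := one_add_mul_le_pow (a := (99 : ℝ)) (by norm_num) d
    have h3 : 0 < 1 / cs := by positivity
    norm_num at h2
    linarith
  refine hγ.exists_bypass hd hn hC' hN hV1 hV2 hhead hlast ⟨_, he.mem.1, ?_⟩ hx hy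
  simp [boxZ, normInf]

end Perco
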